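/- Let R be a Gorenstein local ring, M a finitely generated R-module of finite Gorenstein dimension, and 0 → M → X → G → 0 a projective hull of M (G totally reflexive, pd_R(X) = G-dim_R(M)). Then syz_R(X) ≥ syz_R(M). -/

import Mathlib

open CategoryTheory

noncomputable section

universe u

variable (R : Type u) [CommRing R]

/-- The `i`-th Ext module of two `R`-modules. -/
abbrev ExtMod (i : ℕ) (M N : ModuleCat.{u} R) : ModuleCat.{u} R :=
  ((Ext R (ModuleCat.{u} R) i).obj (Opposite.op M)).obj N

/-- The `i`-th Tor module of two `R`-modules. -/
abbrev TorMod (i : ℕ) (M N : ModuleCat.{u} R) : ModuleCat.{u} R :=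
  ((Tor' (ModuleCat.{u} R) i).obj M).obj N

/-- `D^⊥`. -/
def perpSet (D : Set (ModuleCat.{u} R)) : Set (ModuleCat.{u} R) :=
  {Y | ∀ X ∈ D, ∀ i : ℕ, 0 < i → Subsingleton (ExtMod R i X Y)}

/-- `E^⊤`. -/
def topSet (E : Set (ModuleCat.{u} R)) : Set (ModuleCat.{u} R) :=
  {X | ∀ Y ∈ E, ∀ i : ℕ, 0 < i → Subsingleton (ExtMod R i X Y)}

/-- depth via maximal lengths of regular sequences in the maximal ideal. -/
def depth [IsLocalRing R] (M : ModuleCat.{u} R) : ℕ :=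
  sSup {n | ∃ rs : List R, rs.length = n ∧ (∀ r ∈ rs, r ∈ IsLocalRing.maximalIdeal R) ∧
    RingTheory.Sequence.IsRegular M rs}

/-- `pd_R M ≤ n` via free syzygies. -/
def ProjDimLE : ℕ → ModuleCat.{u} R → Prop
  | 0, M => Projective M
  | n+1, M => ∃ (K F : ModuleCat.{u} R) (f : K ⟶ F) (g : F ⟶ M) (w : f ≫ g = 0),
      Module.Free R F ∧ (ShortComplex.mk f g w).ShortExact ∧ ProjDimLE n K

/-- Projective dimension, in `ℕ∞`. -/
def projDim (M : ModuleCat.{u} R) : ℕ∞ :=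
  sInf {d : ℕ∞ | ∃ n : ℕ, d = n ∧ ProjDimLE R n M}

/-- Totally reflexive modules. -/
def TotallyReflexive (M : ModuleCat.{u} R) : Prop :=
  Function.Bijective (Module.Dual.eval R M) ∧
  (∀ i : ℕ, 0 < i → Subsingleton (ExtMod R i M (ModuleCat.of R R))) ∧
  (∀ i : ℕ, 0 < i → Subsingleton (ExtMod R i (ModuleCat.of R (Module.Dual R M)) (ModuleCat.of R R)))

/-- `G-dim_R M ≤ n` via syzygies. -/
def GdimLE : ℕ → ModuleCat.{u} R → Prop
  | 0, M => TotallyReflexive R M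
  | n+1, M => ∃ (K F : ModuleCat.{u} R) (f : K ⟶ F) (g : F ⟶ M) (w : f ≫ g = 0),
      Module.Free R F ∧ (ShortComplex.mk f g w).ShortExact ∧ GdimLE n K

/-- Gorenstein dimension, in `ℕ∞`. -/
def Gdim (M : ModuleCat.{u} R) : ℕ∞ :=
  sInf {d : ℕ∞ | ∃ n : ℕ, d = n ∧ GdimLE R n M}

/-- `M` is an `n`-th syzygy module. -/
def IsNthSyzygy : ℕ → ModuleCat.{u} R → Prop
  | 0, _ => True
  | n+1, M => ∃ (F C : ModuleCat.{u} R) (f : M ⟶ F) (g : F ⟶ C) (w : f ≫ g = 0),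
      Module.Free R F ∧ (ShortComplex.mk f g w).ShortExact ∧ IsNthSyzygy n C

/-- `syz_R M`: the largest `t ≤ depth R` such that `M` is a `t`-th syzygy. -/
def syz [IsLocalRing R] (M : ModuleCat.{u} R) : ℕ :=
  sSup {t | t ≤ depth R (ModuleCat.of R R) ∧ IsNthSyzygy R t M}

/-- Complexity of a sequence of natural numbers. -/
def seqComplexity (b : ℕ → ℕ) : ℕ :=
  sInf {r : ℕ | ∃ α : ℝ, ∀ᶠ n in Filter.atTop, (b n : ℝ) ≤ α * (n : ℝ) ^ ((r : ℝ) - 1)}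

/-- Minimal number of generators. -/
def numGen (M : ModuleCat.{u} R) : ℕ :=
  sInf {n | ∃ s : Finset M, s.card = n ∧ Submodule.span R (s : Set M) = ⊤}

/-- Complexity of a pair of modules. -/
def cx (M N : ModuleCat.{u} R) : ℕ :=
  seqComplexity (fun i => numGen R (ExtMod R i M N))

/-- Regular local ring: Noetherian local, maximal ideal generated by a regular sequence. -/
def IsRegularLocal (Q : Type u) [CommRing Q] : Prop :=
  IsLocalRing Q ∧ IsNoetherianRing Q ∧
  ∃ rs : List Q, RingTheory.Sequence.IsRegular Q rs ∧ (Ideal.span {x | x ∈ rs}).IsMaximal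

/-- Local complete intersection ring: the completion is a regular local ring
modulo a regular sequence. -/
def IsCompleteIntersectionLocal (R : Type u) [CommRing R] [IsLocalRing R] : Prop :=
  ∃ (Q : CommRingCat.{u})
    (φ : ↥Q →+* AdicCompletion (IsLocalRing.maximalIdeal R) R),
    IsRegularLocal ↥Q ∧ Function.Surjective φ ∧
    ∃ rs : List ↥Q, RingTheory.Sequence.IsRegular (↥Q) rs ∧
      RingHom.ker φ = Ideal.span {x | x ∈ rs}

/-- Gorenstein local ring: `R` has finite injective dimension over itself,
expressed via eventual vanishing of `Ext^i(-, R)`. -/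
def IsGorensteinLocal (R : Type u) [CommRing R] : Prop :=
  IsLocalRing R ∧ IsNoetherianRing R ∧
  ∃ n : ℕ, ∀ (M : ModuleCat.{u} R) (i : ℕ), n < i → Subsingleton (ExtMod R i M (ModuleCat.of R R))

lemma subsingleton_ext_of_extMod {M N : ModuleCat.{u} R} {i : ℕ} (hi : 0 < i)
    (h : Subsingleton (ExtMod R i M N)) : Subsingleton (Abelian.Ext M N i) := by
  obtain ⟨p, rfl⟩ : ∃ p, i = p + 1 := ⟨i - 1, by omega⟩
  let P := projectiveResolution M
  have hz : Limits.IsZero ((P.complex.linearYonedaObj R N).homology (p + 1)) :=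
    (ModuleCat.isZero_of_subsingleton _).of_iso (P.isoExt (p + 1) N).symm
  rw [← HomologicalComplex.exactAt_iff_isZero_homology,
    HomologicalComplex.exactAt_iff' _ p (p + 1) (p + 2) (by simp) (by simp),
    ShortComplex.moduleCat_exact_iff] at hz
  refine subsingleton_of_forall_eq 0 fun α ↦ ?_
  obtain ⟨f, hf, rfl⟩ := P.extMk_surjective α (p + 2) rfl
  rw [P.extMk_eq_zero_iff f (p + 2) rfl hf p rfl]
  obtain ⟨g, hg⟩ := hz f hf
  exact ⟨g, hg⟩

section
variable {R}
open Abelian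

lemma shortExact_mk_iff {A B C : ModuleCat.{u} R} (f : A ⟶ B) (g : B ⟶ C) (w : f ≫ g = 0) :
    (ShortComplex.mk f g w).ShortExact ↔
      Function.Injective f ∧ Function.Exact f g ∧ Function.Surjective g := by
  constructor
  · intro h
    exact ⟨h.moduleCat_injective_f,
      (ShortComplex.ShortExact.moduleCat_exact_iff_function_exact _).1 h.exact,
      h.moduleCat_surjective_g⟩
  · rintro ⟨h1, h2, h3⟩
    exact ShortComplex.ShortExact.mk'
      ((ShortComplex.ShortExact.moduleCat_exact_iff_function_exact _).2 h2)
      ((ModuleCat.mono_iff_injective _).2 h1) ((ModuleCat.epi_iff_surjective _).2 h3)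

lemma shortExact_of_linearMap {A B C : Type u} [AddCommGroup A] [AddCommGroup B] [AddCommGroup C]
    [Module R A] [Module R B] [Module R C] {f : A →ₗ[R] B} {g : B →ₗ[R] C}
    (h1 : Function.Injective f) (h2 : Function.Exact f g) (h3 : Function.Surjective g) :
    (ShortComplex.mk (ModuleCat.ofHom f) (ModuleCat.ofHom g)
      (ModuleCat.hom_ext h2.linearMap_comp_eq_zero)).ShortExact :=
  (shortExact_mk_iff _ _ _).2 ⟨h1, h2, h3⟩

variable {S : ShortComplex (ModuleCat.{u} R)}

lemma subsingleton_ext_X₁ (hS : S.ShortExact) (Y : ModuleCat.{u} R) {n : ℕ}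
    (h₂ : Subsingleton (Ext S.X₂ Y n))
    (h₃ : Subsingleton (Ext S.X₃ Y (n + 1))) : Subsingleton (Ext S.X₁ Y n) := by
  refine subsingleton_of_forall_eq 0 fun α ↦ ?_
  obtain ⟨β, rfl⟩ := Ext.contravariant_sequence_exact₁ hS Y α (add_comm 1 n)
    (Subsingleton.elim _ _)
  rw [Subsingleton.elim β 0, Ext.comp_zero]

lemma subsingleton_ext_X₂ (hS : S.ShortExact) (Y : ModuleCat.{u} R) {n : ℕ}
    (h₁ : Subsingleton (Ext S.X₁ Y n))
    (h₃ : Subsingleton (Ext S.X₃ Y n)) : Subsingleton (Ext S.X₂ Y n) := by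
  refine subsingleton_of_forall_eq 0 fun α ↦ ?_
  obtain ⟨β, rfl⟩ := Ext.contravariant_sequence_exact₂ hS Y α (Subsingleton.elim _ _)
  rw [Subsingleton.elim β 0, Ext.comp_zero]

lemma subsingleton_ext_X₃ (hS : S.ShortExact) (Y : ModuleCat.{u} R) {n : ℕ}
    (h₁ : Subsingleton (Ext S.X₁ Y n))
    (h₂ : Subsingleton (Ext S.X₂ Y (n + 1))) : Subsingleton (Ext S.X₃ Y (n + 1)) := by
  refine subsingleton_of_forall_eq 0 fun α ↦ ?_
  obtain ⟨β, rfl⟩ := Ext.contravariant_sequence_exact₃ hS Y α (Subsingleton.elim _ _)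
    (add_comm 1 n)
  rw [Subsingleton.elim β 0, Ext.comp_zero]

lemma subsingleton_ext_to_X₃ (hS : S.ShortExact) (Y : ModuleCat.{u} R) {n : ℕ}
    (h₂ : Subsingleton (Ext Y S.X₂ n))
    (h₁ : Subsingleton (Ext Y S.X₁ (n + 1))) : Subsingleton (Ext Y S.X₃ n) := by
  refine subsingleton_of_forall_eq 0 fun α ↦ ?_
  obtain ⟨β, rfl⟩ := Ext.covariant_sequence_exact₃ Y hS α rfl (Subsingleton.elim _ _)
  rw [Subsingleton.elim β 0, Ext.zero_comp]

lemma exists_lift_of_subsingleton_ext (hS : S.ShortExact) (Y : ModuleCat.{u} R)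
    (h : Subsingleton (Ext Y S.X₁ 1)) (f : Y ⟶ S.X₃) :
    ∃ g : Y ⟶ S.X₂, g ≫ S.g = f := by
  obtain ⟨β, hβ⟩ := Ext.covariant_sequence_exact₃ Y hS (Ext.mk₀ f) rfl (Subsingleton.elim _ _)
  obtain ⟨g, rfl⟩ := Ext.homEquiv₀.symm.surjective β
  refine ⟨g, Ext.homEquiv₀.symm.injective ?_⟩
  simpa using hβ

lemma exists_extension_of_subsingleton_ext (hS : S.ShortExact) (Y : ModuleCat.{u} R)
    (h : Subsingleton (Ext S.X₃ Y 1)) (f : S.X₁ ⟶ Y) :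
    ∃ g : S.X₂ ⟶ Y, S.f ≫ g = f := by
  obtain ⟨β, hβ⟩ := Ext.contravariant_sequence_exact₁ hS Y (Ext.mk₀ f) rfl
    (Subsingleton.elim _ _)
  obtain ⟨g, rfl⟩ := Ext.homEquiv₀.symm.surjective β
  refine ⟨g, Ext.homEquiv₀.symm.injective ?_⟩
  simpa using hβ

lemma subsingleton_ext_of_linearEquiv (Y : ModuleCat.{u} R) {M N : ModuleCat.{u} R} (e : M ≃ₗ[R] N)
    {n : ℕ} (h : Subsingleton (Ext M Y n)) : Subsingleton (Ext N Y n) := by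
  refine subsingleton_of_forall_eq 0 fun α ↦ ?_
  have : α = (Ext.mk₀ e.symm.toModuleIso.hom).comp
      ((Ext.mk₀ e.symm.toModuleIso.inv).comp α (zero_add n)) (zero_add n) := by
    rw [← Ext.comp_assoc_of_second_deg_zero, Ext.mk₀_comp_mk₀, Iso.hom_inv_id, Ext.mk₀_id_comp]
  rw [this, Subsingleton.elim ((Ext.mk₀ e.symm.toModuleIso.inv).comp α (zero_add n)) 0,
    Ext.comp_zero]

lemma smul_ext_eq_zero {x : R} {N M : ModuleCat.{u} R} (hx : ∀ y : N, x • y = 0) {n : ℕ}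
    (α : Ext N M n) : x • α = 0 := by
  have h0 : x • 𝟙 N = 0 := by
    ext y; exact hx y
  have : x • α = (Ext.mk₀ (x • 𝟙 N)).comp α (zero_add n) := by
    rw [Ext.mk₀_smul, Ext.smul_comp, Ext.mk₀_id_comp]
  rw [this, h0, Ext.mk₀_zero, Ext.zero_comp]

lemma comp_mk₀_smul_id (x : R) {N M : ModuleCat.{u} R} {n : ℕ} (α : Ext N M n) :
    α.comp (Ext.mk₀ (x • 𝟙 M)) (add_zero n) = x • α := by
  rw [Ext.mk₀_smul, Ext.comp_smul, Ext.comp_mk₀_id]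

/-- `RegChain M xs B`: the sequence `xs` is weakly regular on `M` and `B ≅ M / xs M`. -/
inductive RegChain : ModuleCat.{u} R → List R → ModuleCat.{u} R → Prop
  | nil (M : ModuleCat.{u} R) : RegChain M [] M
  | cons {M C B : ModuleCat.{u} R} {x : R} {xs : List R} (g : M ⟶ C) (w : (x • 𝟙 M) ≫ g = 0)
      (hS : (ShortComplex.mk (x • 𝟙 M) g w).ShortExact) (h : RegChain C xs B) :
      RegChain M (x :: xs) B

namespace RegChain
variable {M B : ModuleCat.{u} R} {xs : List R}

lemma exists_lift (h : RegChain M xs B) : ∃ π : M ⟶ B, Function.Surjective π ∧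
    ∀ G : ModuleCat.{u} R, (∀ i, 0 < i → Subsingleton (Ext G M i)) →
      (∀ i, 0 < i → Subsingleton (Ext G B i)) ∧ ∀ f : G ⟶ B, ∃ g : G ⟶ M, g ≫ π = f := by
  induction h with
  | nil M => exact ⟨𝟙 M, fun y ↦ ⟨y, rfl⟩, fun G hG ↦ ⟨hG, fun f ↦ ⟨f, by simp⟩⟩⟩
  | @cons M C B x xs p w hS h ih =>
    obtain ⟨π, hπ, H⟩ := ih
    refine ⟨p ≫ π, ?_, fun G hG ↦ ?_⟩
    · have := hπ.comp hS.moduleCat_surjective_g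
      simpa using this
    · have h1 := H G fun i hi ↦ subsingleton_ext_to_X₃ hS G (hG i hi) (hG (i + 1) (by omega))
      refine ⟨h1.1, fun f ↦ ?_⟩
      obtain ⟨g, rfl⟩ := h1.2 f
      obtain ⟨g', rfl⟩ := exists_lift_of_subsingleton_ext hS G (hG 1 one_pos) g
      exact ⟨g', by simp⟩

lemma subsingleton_ext (h : RegChain M xs B) (Z : ModuleCat.{u} R) {a : ℕ}
    (hM : ∀ i, a < i → Subsingleton (Ext M Z i)) :
    ∀ i, a + xs.length < i → Subsingleton (Ext B Z i) := by
  induction h generalizing a with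
  | nil M => simpa using hM
  | @cons M C B x xs p w hS h ih =>
    intro i hi
    refine ih (a := a + 1) (fun j hj ↦ ?_) i (by simp at hi; omega)
    obtain ⟨j, rfl⟩ : ∃ k, j = k + 1 := ⟨j - 1, by omega⟩
    exact subsingleton_ext_X₃ hS Z (hM j (by omega)) (hM (j + 1) (by omega))

lemma subsingleton_ext_of_lt (h : RegChain M xs B) {N : ModuleCat.{u} R}
    (hN : ∀ x ∈ xs, ∀ y : N, x • y = 0) : ∀ i < xs.length, Subsingleton (Ext N M i) := by
  induction h with
  | nil M => simp
  | @cons M C B x xs p w hS h ih =>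
    intro i hi
    refine subsingleton_of_forall_eq 0 fun α ↦ ?_
    have hα := comp_mk₀_smul_id x α
    rw [smul_ext_eq_zero (hN x (by simp))] at hα
    cases i with
    | zero =>
      have : Mono (x • 𝟙 M) := hS.mono_f
      refine Ext.postcomp_mk₀_injective_of_mono N (x • 𝟙 M) ?_
      rw [map_zero]
      exact hα
    | succ i =>
      obtain ⟨β, rfl⟩ := Ext.covariant_sequence_exact₁ N hS α hα rfl
      have := ih (fun x hx ↦ hN x (by simp [hx])) i (by simpa using hi)
      have hβ : β = 0 := Subsingleton.elim (α := Ext N C i) β 0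
      rw [hβ, Ext.zero_comp]

lemma exists_extension (h : RegChain M xs B) {N' N : ModuleCat.{u} R} (f : N' ⟶ N)
    (hN : ∀ x ∈ xs, ∀ y : N, x • y = 0) (hN' : ∀ x ∈ xs, ∀ y : N', x • y = 0)
    (H : ∀ α : Ext N' M xs.length, ∃ β : Ext N M xs.length,
      (Ext.mk₀ f).comp β (zero_add _) = α) (φ : N' ⟶ B) : ∃ ψ : N ⟶ B, f ≫ ψ = φ := by
  induction h with
  | nil M =>
    obtain ⟨β, hβ⟩ := H (Ext.mk₀ φ)
    obtain ⟨g, rfl⟩ := Ext.homEquiv₀.symm.surjective β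
    exact ⟨g, Ext.homEquiv₀.symm.injective (by simpa using hβ)⟩
  | @cons M C B x xs p w hS h ih =>
    refine ih (fun x hx ↦ hN x (by simp [hx])) (fun x hx ↦ hN' x (by simp [hx])) (fun α ↦ ?_) φ
    change Ext N' (ShortComplex.mk (x • 𝟙 M) p w).X₃ xs.length at α
    obtain ⟨β, hβ⟩ := H (α.comp hS.extClass rfl)
    have hβ0 := comp_mk₀_smul_id x β
    rw [smul_ext_eq_zero (hN x (by simp))] at hβ0
    obtain ⟨γ, rfl⟩ := Ext.covariant_sequence_exact₁ N hS β hβ0 rfl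
    refine ⟨γ, ?_⟩
    have h0 : ((Ext.mk₀ f).comp γ (zero_add _) - α).comp hS.extClass rfl = 0 := by
      rw [sub_eq_add_neg, Ext.add_comp, Ext.neg_comp, ← sub_eq_add_neg, sub_eq_zero, ← hβ,
        Ext.comp_assoc _ _ _ _ _ (by simp)]
    obtain ⟨δ, hδ⟩ := Ext.covariant_sequence_exact₃ N' hS _ rfl h0
    have := (cons p w hS h).subsingleton_ext_of_lt hN' xs.length (by simp)
    have hδ' : δ = 0 := Subsingleton.elim (α := Ext N' M xs.length) δ 0
    rw [hδ', Ext.zero_comp] at hδ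
    exact sub_eq_zero.1 hδ.symm

lemma smul_eq_zero_of_source (h : RegChain M xs B) {x : R} (hM : ∀ b : M, x • b = 0) (b : B) :
    x • b = 0 := by
  obtain ⟨π, hπ, -⟩ := h.exists_lift
  obtain ⟨b, rfl⟩ := hπ b
  rw [← map_smul, hM, map_zero]

lemma smul_eq_zero (h : RegChain M xs B) : ∀ x ∈ xs, ∀ b : B, x • b = 0 := by
  induction h with
  | nil => exact fun x hx ↦ absurd hx List.not_mem_nil
  | @cons M C B x xs p w hS h ih =>
    intro y hy
    rcases List.mem_cons.1 hy with rfl | hy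
    · refine h.smul_eq_zero_of_source fun c ↦ ?_
      obtain ⟨b, rfl⟩ := hS.moduleCat_surjective_g c
      exact (map_smul p.hom y b).symm.trans (ConcreteCategory.congr_hom w b)
    · exact ih y hy

end RegChain

section cyclic
open IsLocalRing

lemma exists_smul_shortExact {M : ModuleCat.{u} R} {x : R} (hx : IsSMulRegular M x) :
    ∃ (g : M ⟶ ModuleCat.of R (QuotSMulTop x M)) (w : (x • 𝟙 M) ≫ g = 0),
      (ShortComplex.mk (x • 𝟙 M) g w).ShortExact := by
  have h := hx.smulShortComplex_shortExact
  exact ⟨_, _, h⟩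

lemma exists_regChain_of_cyclic [IsLocalRing R] [IsNoetherianRing R] (M : ModuleCat.{u} R)
    [Nontrivial M] (π : R →ₗ[R] M) (hπ : Function.Surjective π) :
    ∃ (xs : List R) (B : ModuleCat.{u} R), RegChain M xs B ∧
      ∀ x ∈ maximalIdeal R, ¬ IsSMulRegular B x := by
  obtain ⟨I, hI⟩ : ∃ I, I = Module.annihilator R M := ⟨_, rfl⟩
  induction I using WellFoundedGT.induction generalizing M with
  | ind I ih =>
  by_cases H : ∀ x ∈ maximalIdeal R, ¬ IsSMulRegular M x
  · exact ⟨[], M, .nil M, H⟩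
  push Not at H
  obtain ⟨x, hxm, hx⟩ := H
  obtain ⟨g, w, hS⟩ := exists_smul_shortExact hx
  have : Module.Finite R M := .of_surjective π hπ
  have hnt : Nontrivial (QuotSMulTop x M) := by
    refine Submodule.Quotient.nontrivial_iff.2 fun h ↦ ?_
    exact Submodule.top_ne_pointwise_smul_of_mem_jacobson_annihilator
      (maximalIdeal_le_jacobson _ hxm) h.symm
  have hann : Module.annihilator R M < Module.annihilator R (QuotSMulTop x M) := by
    refine lt_of_le_of_ne (LinearMap.annihilator_le_of_surjective (Submodule.mkQ _)
      (Submodule.mkQ_surjective _)) fun h ↦ ?_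
    have hx' : x ∈ Module.annihilator R M := by
      rw [h, Module.mem_annihilator]
      rintro ⟨b⟩
      exact (Submodule.Quotient.mk_eq_zero _).2 (Submodule.smul_mem_pointwise_smul b x ⊤ trivial)
    obtain ⟨y, hy⟩ := exists_ne (0 : M)
    exact hy (hx (by simp [Module.mem_annihilator.1 hx' y]))
  obtain ⟨xs, B, h, hB⟩ := ih _ (hI ▸ hann) (ModuleCat.of R (QuotSMulTop x M))
    ((Submodule.mkQ _).comp π) ((Submodule.mkQ_surjective _).comp hπ) rfl
  exact ⟨x :: xs, B, .cons g w hS h, hB⟩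

lemma exists_residue_injective [IsLocalRing R] [IsNoetherianRing R] (B : Type u) [AddCommGroup B]
    [Module R B] [Module.Finite R B] (hB : ∀ x ∈ maximalIdeal R, ¬ IsSMulRegular B x) :
    ∃ j : (R ⧸ maximalIdeal R) →ₗ[R] B, Function.Injective j := by
  have h : ¬ Subsingleton ((R ⧸ maximalIdeal R) →ₗ[R] B) := by
    rw [IsSMulRegular.subsingleton_linearMap_iff]
    rintro ⟨r, hr, hr'⟩
    exact hB r (by rwa [Ideal.annihilator_quotient] at hr) hr'
  rw [not_subsingleton_iff_nontrivial] at h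
  obtain ⟨j, hj⟩ := exists_ne (0 : (R ⧸ maximalIdeal R) →ₗ[R] B)
  have : IsSimpleModule R (R ⧸ maximalIdeal R) :=
    isSimpleModule_iff_isCoatom.2 (maximalIdeal.isMaximal R).out
  exact ⟨j, (LinearMap.injective_or_eq_zero j).resolve_right hj⟩

/-- `Ext^n(R/I, Z) = 0` for all ideals `I`. -/
def CyclicExtVanish (Z : ModuleCat.{u} R) (n : ℕ) : Prop :=
  ∀ I : Ideal R, Subsingleton (Ext (ModuleCat.of R (R ⧸ I)) Z n)

lemma subsingleton_ext_of_ker {Z : ModuleCat.{u} R} {n : ℕ} {C : Type u} [AddCommGroup C]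
    [Module R C] (π : R →ₗ[R] C) (hπ : Function.Surjective π)
    (H : Subsingleton (Ext (ModuleCat.of R (R ⧸ LinearMap.ker π)) Z n)) :
    Subsingleton (Ext (ModuleCat.of R C) Z n) :=
  subsingleton_ext_of_linearEquiv (M := ModuleCat.of R (R ⧸ LinearMap.ker π)) Z
    (π.quotKerEquivOfSurjective hπ) H

lemma cyclicExtVanish_of_succ [IsLocalRing R] [IsNoetherianRing R] (Z : ModuleCat.{u} R)
    [Module.Finite R Z] {n : ℕ} (H : CyclicExtVanish Z (n + 1))
    (hk : Subsingleton (Ext (ModuleCat.of R (R ⧸ maximalIdeal R)) Z n)) :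
    CyclicExtVanish Z n := by
  intro I
  induction I using WellFoundedGT.induction with
  | ind I ih =>
  by_cases htop : I = ⊤
  · subst htop
    have : Subsingleton (R ⧸ (⊤ : Ideal R)) := Submodule.Quotient.subsingleton_iff.2 rfl
    have h0 := ModuleCat.isZero_of_subsingleton (ModuleCat.of R (R ⧸ (⊤ : Ideal R)))
    refine subsingleton_of_forall_eq 0 fun α ↦ ?_
    rw [← Ext.mk₀_id_comp α, h0.eq_of_src (𝟙 _) 0, Ext.mk₀_zero, Ext.zero_comp]
  by_cases hm : I = maximalIdeal R
  · exact hm ▸ hk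
  by_cases hpr : ∃ x ∉ I, ∃ y ∉ I, x * y ∈ I
  · obtain ⟨x, hx, y, hy, hxy⟩ := hpr
    let N : Submodule R (R ⧸ I) := Submodule.span R {Ideal.Quotient.mk I x}
    have hS := shortExact_of_linearMap (f := N.subtype) (g := N.mkQ) N.injective_subtype
      (LinearMap.exact_subtype_mkQ N) N.mkQ_surjective
    refine subsingleton_ext_X₂ hS Z ?_ ?_
    · let π : R →ₗ[R] N := (LinearMap.toSpanSingleton R (R ⧸ I) (Ideal.Quotient.mk I x)).codRestrict
        N fun r ↦ Submodule.smul_mem _ _ (Submodule.mem_span_singleton_self _)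
      have hπ : ∀ r, π r = 0 ↔ r * x ∈ I := fun r ↦ by
        rw [← Ideal.Quotient.eq_zero_iff_mem, ← Submodule.coe_eq_zero]
        rfl
      refine subsingleton_ext_of_ker π ?_ (ih _ (lt_of_le_of_ne ?_ ?_))
      · rintro ⟨b, hb⟩
        obtain ⟨r, rfl⟩ := Submodule.mem_span_singleton.1 hb
        exact ⟨r, rfl⟩
      · intro r hr
        exact (hπ r).2 (I.mul_mem_right _ hr)
      · intro h
        exact hy (h ▸ (hπ y).2 (by rwa [mul_comm]))
    · refine subsingleton_ext_of_ker (N.mkQ.comp (Submodule.mkQ I))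
        (N.mkQ_surjective.comp (Submodule.mkQ_surjective I)) (ih _ (lt_of_le_of_ne ?_ ?_))
      · intro r hr
        have : Submodule.mkQ I r = 0 := (Submodule.Quotient.mk_eq_zero _).2 hr
        simp [this]
      · intro h
        refine hx (h ▸ ?_)
        exact (Submodule.Quotient.mk_eq_zero N).2 (Submodule.mem_span_singleton_self _)
  · push Not at hpr
    obtain ⟨x, hxm, hxI⟩ : ∃ x ∈ maximalIdeal R, x ∉ I :=
      SetLike.not_le_iff_exists.1 fun h ↦ hm (le_antisymm (le_maximalIdeal htop) h)
    have hreg : IsSMulRegular (ModuleCat.of R (R ⧸ I)) x := by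
      rw [isSMulRegular_iff_right_eq_zero_of_smul]
      rintro ⟨y⟩ hy
      by_contra hy0
      exact hpr x hxI y (fun h ↦ hy0 (Ideal.Quotient.eq_zero_iff_mem.2 h))
        (Ideal.Quotient.eq_zero_iff_mem.1 hy)
    obtain ⟨g, w, hS⟩ := exists_smul_shortExact hreg
    have hC : Subsingleton (Ext (ModuleCat.of R (QuotSMulTop x (R ⧸ I))) Z (n + 1)) :=
      subsingleton_ext_of_ker ((Submodule.mkQ _).comp (Submodule.mkQ I))
        ((Submodule.mkQ_surjective _).comp (Submodule.mkQ_surjective I)) (H _)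
    have hsurj : ∀ α : Ext (ModuleCat.of R (R ⧸ I)) Z n, ∃ β, x • β = α := by
      intro α
      obtain ⟨β, hβ⟩ := Ext.contravariant_sequence_exact₁ hS Z α (add_comm 1 n)
        (Subsingleton.elim (α := Ext (ModuleCat.of R (QuotSMulTop x (R ⧸ I))) Z (n + 1)) _ _)
      refine ⟨β, ?_⟩
      rw [← hβ]
      change _ = (Ext.mk₀ (x • 𝟙 _)).comp β _
      rw [Ext.mk₀_smul, Ext.smul_comp, Ext.mk₀_id_comp]
    have hfin : Module.Finite R (Ext (ModuleCat.of R (R ⧸ I)) Z n) := inferInstance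
    have := Submodule.eq_bot_of_le_smul_of_le_jacobson_bot (maximalIdeal R)
      (⊤ : Submodule R (Ext (ModuleCat.of R (R ⧸ I)) Z n)) hfin.fg_top (fun α _ ↦ by
        obtain ⟨β, rfl⟩ := hsurj α
        exact Submodule.smul_mem_smul hxm trivial) (maximalIdeal_le_jacobson _)
    exact subsingleton_of_forall_eq 0 fun α ↦ (Submodule.mem_bot R).1 (this ▸ trivial)

lemma subsingleton_ext_of_projective (P Y : ModuleCat.{u} R) [Module.Projective R P] {n : ℕ}
    (hn : 0 < n) : Subsingleton (Ext P Y n) := by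
  obtain ⟨k, rfl⟩ : ∃ k, n = k + 1 := ⟨n - 1, by omega⟩
  have : Projective P := ModuleCat.projective_of_categoryTheory_projective P
  exact Ext.subsingleton_of_projective P Y k

/-- Homomorphisms to `B` extend along injections of modules killed by the annihilator of `B`. -/
def InjectiveModAnnihilator (B : Type u) [AddCommGroup B] [Module R B] : Prop :=
  ∀ (N' N : Type u) [AddCommGroup N'] [AddCommGroup N] [Module R N'] [Module R N]
    (f : N' →ₗ[R] N), Function.Injective f →
    (∀ r ∈ Module.annihilator R B, ∀ y : N, r • y = 0) →
    ∀ φ : N' →ₗ[R] B, ∃ ψ : N →ₗ[R] B, ψ.comp f = φ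

lemma injectiveModAnnihilator_of_baer (B : Type u) [AddCommGroup B] [Module R B]
    (H : ∀ (I : Submodule R (R ⧸ Module.annihilator R B)) (φ : I →ₗ[R] B),
      ∃ ψ : (R ⧸ Module.annihilator R B) →ₗ[R] B, ψ.comp I.subtype = φ) :
    InjectiveModAnnihilator (R := R) B := by
  intro N' N _ _ _ _ f hf hN φ
  set J := Module.annihilator R B
  have hN' : ∀ r ∈ J, ∀ y : N', r • y = 0 := fun r hr y ↦ hf (by simp [hN r hr])
  have tB : Module.IsTorsionBySet R B J := fun b r ↦ Module.mem_annihilator.1 r.2 b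
  have tN : Module.IsTorsionBySet R N J := fun b r ↦ hN r r.2 b
  have tN' : Module.IsTorsionBySet R N' J := fun b r ↦ hN' r r.2 b
  let := tB.module
  let := tN.module
  let := tN'.module
  have := tB.isScalarTower (S := R)
  have := tN.isScalarTower (S := R)
  have := tN'.isScalarTower (S := R)
  have hsurj : Function.Surjective (algebraMap R (R ⧸ J)) := Ideal.Quotient.mk_surjective
  have hb : Module.Baer (R ⧸ J) B := by
    intro I g
    obtain ⟨ψ, hψ⟩ := H (I.restrictScalars R) (g.restrictScalars R)
    exact ⟨ψ.extendScalarsOfSurjective hsurj, fun x hx ↦ LinearMap.congr_fun hψ ⟨x, hx⟩⟩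
  obtain ⟨ψ, hψ⟩ := hb.extension_property (f.extendScalarsOfSurjective hsurj) hf
    (φ.extendScalarsOfSurjective hsurj)
  exact ⟨ψ.restrictScalars R, LinearMap.ext fun x ↦ LinearMap.congr_fun hψ x⟩

lemma exists_cyclic_injectiveModAnnihilator [IsLocalRing R] [IsNoetherianRing R]
    (hR : ∃ n : ℕ, ∀ (M : ModuleCat.{u} R) (i : ℕ), n < i →
      Subsingleton (Ext M (ModuleCat.of R R) i)) :
    ∃ (B : ModuleCat.{u} R) (j : (R ⧸ maximalIdeal R) →ₗ[R] B) (π : R →ₗ[R] B),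
      Function.Injective j ∧ InjectiveModAnnihilator (R := R) B ∧
      ∀ (G : Type u) [AddCommGroup G] [Module R G],
        (∀ i, 0 < i → Subsingleton (Ext (ModuleCat.of R G) (ModuleCat.of R R) i)) →
        ∀ f : G →ₗ[R] B, ∃ g : G →ₗ[R] R, π.comp g = f := by
  obtain ⟨xs, B, h, hreg⟩ := exists_regChain_of_cyclic (ModuleCat.of R R) LinearMap.id
    Function.surjective_id
  obtain ⟨π, hπ, hlift⟩ := h.exists_lift
  have : Module.Finite R B := .of_surjective π.hom hπ
  obtain ⟨j, hj⟩ := exists_residue_injective B hreg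
  refine ⟨B, j, π.hom, hj, injectiveModAnnihilator_of_baer B fun I φ ↦ ?_, ?_⟩
  · have hbase : ∀ n, xs.length < n → Subsingleton (Ext B (ModuleCat.of R R) n) := fun n hn ↦
      h.subsingleton_ext (ModuleCat.of R R) (a := 0)
        (fun i hi ↦ subsingleton_ext_of_projective _ _ hi) n (by omega)
    have step : ∀ n, xs.length < n → CyclicExtVanish (ModuleCat.of R R) (n + 1) →
        CyclicExtVanish (ModuleCat.of R R) n := by
      intro n hn H
      refine cyclicExtVanish_of_succ _ H ?_
      have hS := shortExact_of_linearMap (f := j) (g := (LinearMap.range j).mkQ) hj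
        (LinearMap.exact_map_mkQ_range j) (Submodule.mkQ_surjective _)
      exact subsingleton_ext_X₁ hS _ (hbase n hn)
        (subsingleton_ext_of_ker ((LinearMap.range j).mkQ.comp π.hom)
          ((Submodule.mkQ_surjective _).comp hπ) (H _))
    obtain ⟨n, hn⟩ := hR
    have hall : ∀ k, CyclicExtVanish (ModuleCat.of R R) (xs.length + 1 + (n - k)) := by
      intro k
      induction k with
      | zero => exact fun I ↦ hn _ _ (by omega)
      | succ k ih =>
        rcases Nat.lt_or_ge k n with hk | hk
        · refine step _ (by omega) ?_
          rwa [show xs.length + 1 + (n - (k + 1)) + 1 = xs.length + 1 + (n - k) by omega]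
        · rwa [show n - (k + 1) = n - k by omega]
    have hd : CyclicExtVanish (ModuleCat.of R R) (xs.length + 1) := by simpa using hall n
    have hxs : ∀ x ∈ xs, ∀ y : R ⧸ Module.annihilator R B, x • y = 0 := by
      rintro x hx ⟨y⟩
      exact Ideal.Quotient.eq_zero_iff_mem.2
        (Ideal.mul_mem_right _ _ (Module.mem_annihilator.2 (h.smul_eq_zero x hx)))
    have hS := shortExact_of_linearMap (f := I.subtype) (g := I.mkQ) I.injective_subtype
      (LinearMap.exact_subtype_mkQ I) I.mkQ_surjective
    obtain ⟨ψ, hψ⟩ := h.exists_extension (ModuleCat.ofHom I.subtype) hxs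
      (fun x hx y ↦ Subtype.ext (hxs x hx y)) (fun α ↦
        Ext.contravariant_sequence_exact₁ hS _ α (add_comm 1 _) (by
          have : Subsingleton (Ext (ModuleCat.of R ((R ⧸ Module.annihilator R B) ⧸ I))
              (ModuleCat.of R R) (xs.length + 1)) :=
            subsingleton_ext_of_ker (I.mkQ.comp (Submodule.mkQ _))
              (I.mkQ_surjective.comp (Submodule.mkQ_surjective _)) (hd _)
          exact Subsingleton.elim _ _))
      (ModuleCat.ofHom φ)
    exact ⟨ψ.hom, by rw [← ModuleCat.hom_ofHom φ, ← hψ]; rfl⟩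
  · intro G _ _ hG f
    obtain ⟨g, hg⟩ := (hlift (ModuleCat.of R G) hG).2 (ModuleCat.ofHom f)
    exact ⟨g.hom, by rw [← ModuleCat.hom_ofHom f, ← hg]; rfl⟩

lemma finite_of_injectiveModAnnihilator {k V G B : Type u} [Field k] [Algebra R k]
    [AddCommGroup V] [Module k V] [Module R V] [IsScalarTower R k V]
    [AddCommGroup G] [Module R G] [AddCommGroup B] [Module R B]
    (mk : G →ₗ[R] V) (hmk : Function.Surjective mk)
    (j : k →ₗ[R] B) (hj : Function.Injective j) (π : R →ₗ[R] B)
    (hB : InjectiveModAnnihilator (R := R) B)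
    (hG : Function.Surjective (Module.Dual.eval R G))
    (h₁ : ∀ f : G →ₗ[R] B, ∃ g : G →ₗ[R] R, π.comp g = f)
    (h₂ : ∀ f : Module.Dual R G →ₗ[R] B, ∃ g : Module.Dual R G →ₗ[R] R, π.comp g = f) :
    Module.Finite k V := by
  let L : Module.Dual k V →ₗ[R] (G →ₗ[R] B) :=
    { toFun := fun ψ ↦ (j.comp (ψ.restrictScalars R)).comp mk
      map_add' := fun ψ ψ' ↦ LinearMap.ext fun g ↦ map_add j _ _
      map_smul' := fun r ψ ↦ LinearMap.ext fun g ↦ map_smul j r _ }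
  have hLapp : ∀ ψ g, L ψ g = j (ψ (mk g)) := fun _ _ ↦ rfl
  have hL : Function.Injective L := by
    intro ψ ψ' h
    refine LinearMap.ext fun v ↦ ?_
    obtain ⟨g, rfl⟩ := hmk v
    exact hj (LinearMap.congr_fun h g)
  clear_value L
  have hsurj : Function.Surjective (Module.Dual.eval k V) := by
    intro Φ
    obtain ⟨Ψ, hΨ⟩ := hB _ _ L hL
      (fun r hr f ↦ LinearMap.ext fun g ↦ Module.mem_annihilator.1 hr (f g))
      (j.comp (Φ.restrictScalars R))
    obtain ⟨γ, hγ⟩ := h₂ (Ψ.comp (LinearMap.compRight R π))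
    obtain ⟨g, rfl⟩ := hG γ
    refine ⟨mk g, LinearMap.ext fun ψ ↦ hj ?_⟩
    obtain ⟨f, hf⟩ := h₁ (L ψ)
    have e1 : Ψ (L ψ) = j (Φ ψ) := LinearMap.congr_fun hΨ ψ
    have e2 : π (f g) = Ψ (π.comp f) := LinearMap.congr_fun hγ f
    have e3 : π (f g) = L ψ g := LinearMap.congr_fun hf g
    rw [Module.Dual.eval_apply, ← hLapp, ← e1, ← hf, ← e2, e3, hf]
  have : Module.IsReflexive k V := ⟨⟨LinearMap.ker_eq_bot.1 (Module.eval_ker k V), hsurj⟩⟩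
  infer_instance

lemma finite_quotient_of_reflexive [IsLocalRing R] [IsNoetherianRing R]
    (hR : ∃ n : ℕ, ∀ (M : ModuleCat.{u} R) (i : ℕ), n < i →
      Subsingleton (Ext M (ModuleCat.of R R) i))
    (G : Type u) [AddCommGroup G] [Module R G]
    (hG : Function.Surjective (Module.Dual.eval R G))
    (h₁ : ∀ i, 0 < i → Subsingleton (Ext (ModuleCat.of R G) (ModuleCat.of R R) i))
    (h₂ : ∀ i, 0 < i →
      Subsingleton (Ext (ModuleCat.of R (Module.Dual R G)) (ModuleCat.of R R) i)) :
    Module.Finite R (G ⧸ (maximalIdeal R • ⊤ : Submodule R G)) := by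
  obtain ⟨B, j, π, hj, hB, hlift⟩ := exists_cyclic_injectiveModAnnihilator hR
  let : Field (R ⧸ maximalIdeal R) := Ideal.Quotient.field (maximalIdeal R)
  have := finite_of_injectiveModAnnihilator (maximalIdeal R • ⊤ : Submodule R G).mkQ
    (Submodule.mkQ_surjective _) j hj π hB hG (hlift G h₁) (hlift _ h₂)
  exact Module.Finite.trans (R ⧸ maximalIdeal R) _

lemma finite_of_reflexive [IsLocalRing R] [IsNoetherianRing R]
    (hR : ∃ n : ℕ, ∀ (M : ModuleCat.{u} R) (i : ℕ), n < i →
      Subsingleton (Ext M (ModuleCat.of R R) i))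
    (G : Type u) [AddCommGroup G] [Module R G]
    (hG : Function.Bijective (Module.Dual.eval R G))
    (h₁ : ∀ i, 0 < i → Subsingleton (Ext (ModuleCat.of R G) (ModuleCat.of R R) i))
    (h₂ : ∀ i, 0 < i →
      Subsingleton (Ext (ModuleCat.of R (Module.Dual R G)) (ModuleCat.of R R) i)) :
    Module.Finite R G := by
  have hV := finite_quotient_of_reflexive hR G hG.2 h₁ h₂
  obtain ⟨n, q, hq⟩ := Module.Finite.exists_fin' R (G ⧸ (maximalIdeal R • ⊤ : Submodule R G))
  obtain ⟨q', hq'⟩ := Module.projective_lifting_property (Submodule.mkQ _) q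
    (Submodule.mkQ_surjective _)
  have hsup : LinearMap.range q' ⊔ maximalIdeal R • ⊤ = ⊤ := by
    refine eq_top_iff.2 fun g _ ↦ ?_
    obtain ⟨a, ha⟩ := hq (Submodule.mkQ _ g)
    rw [← hq'] at ha
    have := (Submodule.Quotient.eq _).1 ha.symm
    rw [← sub_add_cancel g (q' a)]
    exact add_mem (Submodule.mem_sup_right this) (Submodule.mem_sup_left ⟨a, rfl⟩)
  have hinj : Function.Injective (q'.dualMap) := by
    rw [injective_iff_map_eq_zero]
    intro f hf
    have hr : LinearMap.range f ≤ maximalIdeal R • LinearMap.range f := by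
      have h0 : (LinearMap.range q').map f = ⊥ := by
        rw [← LinearMap.range_comp, LinearMap.range_eq_bot]; exact hf
      rw [LinearMap.range_eq_map]
      conv_lhs => rw [← hsup, Submodule.map_sup, h0, bot_sup_eq, Submodule.map_smul'']
    exact LinearMap.range_eq_bot.1 (Submodule.eq_bot_of_le_smul_of_le_jacobson_bot
      (maximalIdeal R) _ (IsNoetherian.noetherian _) hr (maximalIdeal_le_jacobson _))
  have : Module.Finite R (Module.Dual R G) := Module.Finite.of_injective _ hinj
  exact Module.Finite.of_injective _ hG.1
end cyclic

lemma subsingleton_ext_one_of_forall_extension (hS : S.ShortExact) (Y : ModuleCat.{u} R)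
    (h₂ : Subsingleton (Ext S.X₂ Y 1))
    (H : ∀ f : S.X₁ ⟶ Y, ∃ g : S.X₂ ⟶ Y, S.f ≫ g = f) : Subsingleton (Ext S.X₃ Y 1) := by
  refine subsingleton_of_forall_eq 0 fun α ↦ ?_
  obtain ⟨β, rfl⟩ := Ext.contravariant_sequence_exact₃ hS Y α (Subsingleton.elim _ _)
    (add_zero 1)
  obtain ⟨f, rfl⟩ := Ext.homEquiv₀.symm.surjective β
  obtain ⟨g, rfl⟩ := H f
  change hS.extClass.comp (Ext.mk₀ (S.f ≫ g)) _ = 0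
  rw [← Ext.mk₀_comp_mk₀, hS.extClass_comp_assoc]

/-- Finitely generated totally reflexive modules. -/
structure FiniteTotallyReflexive (G : Type u) [AddCommGroup G] [Module R G] : Prop where
  finite : Module.Finite R G
  bijective_eval : Function.Bijective (Module.Dual.eval R G)
  ext : ∀ i, 0 < i → Subsingleton (Ext (ModuleCat.of R G) (ModuleCat.of R R) i)
  ext_dual : ∀ i, 0 < i →
    Subsingleton (Ext (ModuleCat.of R (Module.Dual R G)) (ModuleCat.of R R) i)

lemma exists_linearMap_extension {A B C : Type u} [AddCommGroup A] [AddCommGroup B]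
    [AddCommGroup C] [Module R A] [Module R B] [Module R C] {f : A →ₗ[R] B} {g : B →ₗ[R] C}
    (h1 : Function.Injective f) (h2 : Function.Exact f g) (h3 : Function.Surjective g)
    {Z : Type u} [AddCommGroup Z] [Module R Z]
    (h : Subsingleton (Ext (ModuleCat.of R C) (ModuleCat.of R Z) 1)) (φ : A →ₗ[R] Z) :
    ∃ ψ : B →ₗ[R] Z, ψ.comp f = φ := by
  obtain ⟨ψ, hψ⟩ := exists_extension_of_subsingleton_ext (shortExact_of_linearMap h1 h2 h3)
    (ModuleCat.of R Z) h (ModuleCat.ofHom φ)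
  exact ⟨ψ.hom, by rw [← ModuleCat.hom_ofHom φ, ← hψ]; rfl⟩

lemma subsingleton_ext_one_free [IsNoetherianRing R] {G F : Type u} [AddCommGroup G]
    [Module R G] [AddCommGroup F] [Module R F] [Module.Free R F] [Module.Finite R G]
    (h : Subsingleton (Ext (ModuleCat.of R G) (ModuleCat.of R R) 1)) :
    Subsingleton (Ext (ModuleCat.of R G) (ModuleCat.of R F) 1) := by
  obtain ⟨n, q, hq⟩ := Module.Finite.exists_fin' R G
  have hex : Function.Exact (LinearMap.ker q).subtype q := LinearMap.exact_subtype_ker_map q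
  refine subsingleton_ext_one_of_forall_extension
    (shortExact_of_linearMap (LinearMap.ker q).injective_subtype hex hq) _
    (subsingleton_ext_of_projective _ _ one_pos) fun h' ↦ ?_
  let φ : LinearMap.ker q →ₗ[R] F := h'.hom
  let b := Module.Free.chooseBasis R F
  obtain ⟨s, hs⟩ : (⊤ : Submodule R (LinearMap.ker q)).FG := IsNoetherian.noetherian _
  classical
  let T : Finset (Module.Free.ChooseBasisIndex R F) :=
    s.biUnion fun x ↦ (b.repr (φ x)).support
  have hT : ∀ x, b.repr (φ x) ∈ Finsupp.supported R R (T : Set _) := by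
    have : ⊤ ≤ (Finsupp.supported R R (T : Set _)).comap (b.repr.toLinearMap.comp φ) := by
      rw [← hs, Submodule.span_le]
      intro x hx
      exact Finset.coe_subset.2
        (Finset.subset_biUnion_of_mem (fun x ↦ (b.repr (φ x)).support) hx)
    exact fun x ↦ this trivial
  have hc : ∀ t, ∃ ψ : (Fin n → R) →ₗ[R] R,
      ψ.comp (LinearMap.ker q).subtype = (b.coord t).comp φ := fun t ↦
    exists_linearMap_extension (LinearMap.ker q).injective_subtype hex hq h _
  choose ψ hψ using hc
  refine ⟨ModuleCat.ofHom (∑ t ∈ T, (ψ t).smulRight (b t)), ?_⟩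
  ext x
  change (∑ t ∈ T, (ψ t).smulRight (b t)) x.1 = φ x
  have h2 : ∀ t, ψ t x.1 = b.repr (φ x) t := fun t ↦ LinearMap.congr_fun (hψ t) x
  simp only [LinearMap.sum_apply, LinearMap.smulRight_apply, h2]
  conv_rhs => rw [← b.linearCombination_repr (φ x)]
  rw [Finsupp.linearCombination_apply, Finsupp.sum_of_support_subset _ (hT x) _ (by simp)]

lemma bijective_eval_ker [IsNoetherianRing R] {G F : Type u} [AddCommGroup G] [Module R G]
    [AddCommGroup F] [Module R F] [Module.IsReflexive R F] (q : F →ₗ[R] Module.Dual R G)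
    (hsurj : Function.Surjective (LinearMap.ker q).subtype.dualMap) :
    Function.Bijective (Module.Dual.eval R (LinearMap.ker q)) := by
  constructor
  · intro x y h
    refine Subtype.ext ((Module.bijective_dual_eval R F).1 (LinearMap.ext fun θ ↦ ?_))
    exact LinearMap.congr_fun h ((LinearMap.ker q).subtype.dualMap θ)
  · intro κ
    obtain ⟨f, hf⟩ := (Module.bijective_dual_eval R F).2
      (κ.comp (LinearMap.ker q).subtype.dualMap)
    have hf' : ∀ θ : Module.Dual R F, θ f = κ ((LinearMap.ker q).subtype.dualMap θ) :=
      fun θ ↦ LinearMap.congr_fun hf θ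
    have hqf : q f = 0 := by
      ext g
      have h1 := hf' (q.dualMap (Module.Dual.eval R G g))
      have h2 : (LinearMap.ker q).subtype.dualMap (q.dualMap (Module.Dual.eval R G g)) = 0 := by
        ext x
        exact LinearMap.congr_fun (LinearMap.mem_ker.1 x.2) g
      rw [h2, map_zero] at h1
      exact h1
    refine ⟨⟨f, hqf⟩, LinearMap.ext fun φ ↦ ?_⟩
    obtain ⟨θ, rfl⟩ := hsurj φ
    exact hf' θ

lemma exists_comp_eq_of_ker_le {A B C : Type u} [AddCommGroup A] [AddCommGroup B]
    [AddCommGroup C] [Module R A] [Module R B] [Module R C] {g : A →ₗ[R] B}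
    (hg : Function.Surjective g) (h : A →ₗ[R] C) (hk : LinearMap.ker g ≤ LinearMap.ker h) :
    ∃ c : B →ₗ[R] C, ∀ a, c (g a) = h a :=
  ⟨((LinearMap.ker g).liftQ h hk).comp (g.quotKerEquivOfSurjective hg).symm.toLinearMap,
    fun a ↦ by simp [LinearMap.quotKerEquivOfSurjective_symm_apply]⟩

lemma FiniteTotallyReflexive.exists_cosyzygy [IsNoetherianRing R] {G : Type u} [AddCommGroup G]
    [Module R G] (hG : FiniteTotallyReflexive (R := R) G) :
    ∃ (F' G' : ModuleCat.{u} R) (ι : G →ₗ[R] F') (ρ : F' →ₗ[R] G'), Module.Free R F' ∧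
      Function.Injective ι ∧ Function.Exact ι ρ ∧ Function.Surjective ρ ∧
      FiniteTotallyReflexive (R := R) G' := by
  have := hG.finite
  obtain ⟨n, q, hq⟩ := Module.Finite.exists_fin' R (Module.Dual R G)
  let K := LinearMap.ker q
  have hex : Function.Exact K.subtype q := LinearMap.exact_subtype_ker_map q
  have hS := shortExact_of_linearMap K.injective_subtype hex hq
  let ι := q.dualMap.comp (Module.Dual.eval R G)
  let ρ := K.subtype.dualMap
  have hι : Function.Injective ι :=
    (LinearMap.dualMap_injective_of_surjective hq).comp hG.bijective_eval.1
  have hρ : Function.Surjective ρ := fun φ ↦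
    exists_linearMap_extension K.injective_subtype hex hq (hG.ext_dual 1 one_pos) φ
  have hιρ : Function.Exact ι ρ := by
    intro θ
    constructor
    · intro hθ
      obtain ⟨γ, hγ⟩ := exists_comp_eq_of_ker_le hq θ fun x hx ↦ LinearMap.congr_fun hθ ⟨x, hx⟩
      obtain ⟨g, rfl⟩ := hG.bijective_eval.2 γ
      exact ⟨g, LinearMap.ext hγ⟩
    · rintro ⟨g, rfl⟩
      exact LinearMap.ext fun x ↦ LinearMap.congr_fun (LinearMap.mem_ker.1 x.2) g
  have hK := bijective_eval_ker q hρ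
  have hKr : Module.IsReflexive R K := ⟨hK⟩
  have hS' := shortExact_of_linearMap hι hιρ hρ
  have hKext : ∀ i, 0 < i → Subsingleton (Ext (ModuleCat.of R K) (ModuleCat.of R R) i) :=
    fun i hi ↦ subsingleton_ext_X₁ hS _ (subsingleton_ext_of_projective _ _ hi)
      (hG.ext_dual (i + 1) (by omega))
  refine ⟨ModuleCat.of R (Module.Dual R (Fin n → R)), ModuleCat.of R (Module.Dual R K), ι, ρ,
    inferInstanceAs (Module.Free R (Module.Dual R (Fin n → R))), hι, hιρ, hρ,
    inferInstanceAs (Module.Finite R (Module.Dual R K)),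
    Module.bijective_dual_eval R (Module.Dual R K), fun i hi ↦ ?_, fun i hi ↦ ?_⟩
  · obtain rfl | ⟨k, rfl⟩ : i = 1 ∨ ∃ k, i = k + 1 + 1 := by
      rcases i with _ | _ | k
      · omega
      · exact .inl rfl
      · exact .inr ⟨k, rfl⟩
    · refine subsingleton_ext_one_of_forall_extension hS' _
        (subsingleton_ext_of_projective _ _ one_pos) fun h ↦ ?_
      obtain ⟨f, hf⟩ := hq h.hom
      refine ⟨ModuleCat.ofHom (Module.Dual.eval R _ f), ?_⟩
      ext g
      exact LinearMap.congr_fun hf g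
    · exact subsingleton_ext_X₃ hS' _ (hG.ext (k + 1) (by omega))
        (subsingleton_ext_of_projective _ _ (by omega))
  · exact subsingleton_ext_of_linearEquiv (M := ModuleCat.of R K) _
      (LinearEquiv.ofBijective _ hK) (hKext i hi)

lemma isNthSyzygy_of_shortExact [IsNoetherianRing R] (t : ℕ) {M X G : ModuleCat.{u} R}
    (i : M →ₗ[R] X) (p : X →ₗ[R] G) (hi : Function.Injective i) (hip : Function.Exact i p)
    (hp : Function.Surjective p) (hG : FiniteTotallyReflexive (R := R) G)
    (hM : IsNthSyzygy R t M) : IsNthSyzygy R t X := by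
  induction t generalizing M X G with
  | zero => trivial
  | succ t ih =>
    obtain ⟨F, C, f, g, w, hF, hfg, hC⟩ := hM
    obtain ⟨hf, hfg, hg⟩ := (shortExact_mk_iff f g w).1 hfg
    obtain ⟨F', G', ι, ρ, hF', hι, hιρ, hρ, hG'⟩ := hG.exists_cosyzygy
    have := hG.finite
    obtain ⟨e, he⟩ := exists_linearMap_extension hi hip hp
      (subsingleton_ext_one_free (F := F) (hG.ext 1 one_pos)) f.hom
    have he' : ∀ m, e (i m) = f m := fun m ↦ LinearMap.congr_fun he m
    let φ : X →ₗ[R] F × F' := e.prod (ι.comp p)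
    have hφ : Function.Injective φ := by
      rw [injective_iff_map_eq_zero]
      intro x hx
      obtain ⟨hx1, hx2⟩ := Prod.ext_iff.1 hx
      obtain ⟨m, rfl⟩ := (hip x).1 (hι (hx2.trans (map_zero ι).symm))
      have : f m = 0 := (he' m).symm.trans hx1
      rw [hf (this.trans (map_zero f.hom).symm), map_zero]
    let Q := (F × F') ⧸ LinearMap.range φ
    let mk : F × F' →ₗ[R] Q := (LinearMap.range φ).mkQ
    have hmk : Function.Surjective mk := Submodule.mkQ_surjective _
    have hmk0 : ∀ y, mk y = 0 ↔ ∃ x, φ x = y := fun y ↦ Submodule.Quotient.mk_eq_zero _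
    obtain ⟨c, hc⟩ := exists_comp_eq_of_ker_le (g := g.hom) hg
      (mk.comp (LinearMap.inl R F F')) (by
        intro y hy
        obtain ⟨m, rfl⟩ := (hfg y).1 hy
        refine (hmk0 _).2 ⟨i m, Prod.ext (he' m) ?_⟩
        change ι (p (i m)) = 0
        rw [hip.apply_apply_eq_zero, map_zero])
    obtain ⟨r, hr⟩ := exists_comp_eq_of_ker_le hmk (ρ.comp (LinearMap.snd R F F')) (by
        intro y hy
        obtain ⟨x, rfl⟩ := (hmk0 y).1 hy
        exact hιρ.apply_apply_eq_zero (p x))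
    refine ⟨ModuleCat.of R (F × F'), ModuleCat.of R Q, ModuleCat.ofHom φ, ModuleCat.ofHom mk,
      ModuleCat.hom_ext (LinearMap.exact_map_mkQ_range φ).linearMap_comp_eq_zero,
      inferInstanceAs (Module.Free R (F × F')),
      shortExact_of_linearMap hφ (LinearMap.exact_map_mkQ_range φ) hmk,
      ih (X := ModuleCat.of R Q) c r ?_ ?_ ?_ hG' hC⟩
    · rw [injective_iff_map_eq_zero]
      intro z hz
      obtain ⟨y, rfl⟩ := hg z
      obtain ⟨x, hx⟩ := (hmk0 _).1 ((hc y).symm.trans hz)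
      obtain ⟨hx1, hx2⟩ := Prod.ext_iff.1 hx
      obtain ⟨m, rfl⟩ := (hip x).1 (hι (hx2.trans (map_zero ι).symm))
      exact (hfg y).2 ⟨m, (he' m).symm.trans hx1⟩
    · intro z
      constructor
      · intro hz
        obtain ⟨⟨y, v⟩, rfl⟩ := hmk z
        obtain ⟨γ, rfl⟩ := (hιρ v).1 ((hr (y, v)).symm.trans hz)
        obtain ⟨x, rfl⟩ := hp γ
        refine ⟨g (y - e x), (hc _).trans ?_⟩
        rw [← sub_eq_zero, LinearMap.comp_apply, ← map_sub, hmk0]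
        refine ⟨-x, Prod.ext ?_ ?_⟩ <;> simp [φ]
      · rintro ⟨z, rfl⟩
        obtain ⟨y, rfl⟩ := hg z
        change r (c (g.hom y)) = 0
        rw [hc]
        change r (mk (y, 0)) = 0
        rw [hr]
        exact map_zero ρ
    · intro v
      obtain ⟨y, rfl⟩ := hρ v
      exact ⟨mk (0, y), hr _⟩

lemma finiteTotallyReflexive_of_isGorensteinLocal [IsLocalRing R] [IsNoetherianRing R]
    (hR : IsGorensteinLocal R) {G : ModuleCat.{u} R} (hG : TotallyReflexive R G) :
    FiniteTotallyReflexive (R := R) G := by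
  obtain ⟨-, -, n, hn⟩ := hR
  obtain ⟨hb, h₁, h₂⟩ := hG
  have h₁' := fun i hi ↦ subsingleton_ext_of_extMod R hi (h₁ i hi)
  have h₂' := fun i hi ↦ subsingleton_ext_of_extMod R hi (h₂ i hi)
  exact ⟨finite_of_reflexive
    ⟨n, fun M i hi ↦ subsingleton_ext_of_extMod R (by omega) (hn M i hi)⟩ G hb h₁' h₂',
    hb, h₁', h₂'⟩

end

theorem stmt16 (R : Type u) [CommRing R] [IsLocalRing R] [IsNoetherianRing R]
    (hgor : IsGorensteinLocal R)
    (M : ModuleCat.{u} R) (hfg : Module.Finite R M) (hGdim : Gdim R M ≠ ⊤)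
    (X G : ModuleCat.{u} R) (i : M ⟶ X) (p : X ⟶ G) (w : i ≫ p = 0)
    (hse : (ShortComplex.mk i p w).ShortExact)
    (hG : TotallyReflexive R G)
    (hX : projDim R X = Gdim R M) :
    syz R M ≤ syz R X := by
  obtain ⟨hi, hip, hp⟩ := (shortExact_mk_iff i p w).1 hse
  refine csSup_le ⟨0, Nat.zero_le _, trivial⟩ fun t ht ↦ le_csSup ⟨_, fun s hs ↦ hs.1⟩
    ⟨ht.1, ?_⟩
  exact isNthSyzygy_of_shortExact t i.hom p.hom hi hip hp
    (finiteTotallyReflexive_of_isGorensteinLocal hgor hG) ht.2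
end
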